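/- arXiv:1504.06433 — 7 statements merged into one kernel-verified Lean document; each statement's English description precedes it below -/
import Mathlib

section
/- Let λ > 0, let G be an exponential random variable with rate λ, and let N be a standard Gaussian random variable independent of G. Then √G · N has law absolutely continuous with respect to Lebesgue measure on ℝ with density x ↦ (√(2λ)/2) e^{−√(2λ)|x|}. In particular, for λ = 2 the density is x ↦ e^{−2|x|} (the law of the one-dimensional marginal of the Brownian motion iterated ad libitum). -/
open MeasureTheory ProbabilityTheory Real

/-- The characteristic function of the product of independent variables `√G` and `N`, for `N`
standard Gaussian, is the Laplace transform of the law of `G`. -/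
lemma charFun_map_sqrt_mul_gaussian {Ω : Type*} [MeasurableSpace Ω] {P : Measure Ω}
    [IsProbabilityMeasure P] {G N : Ω → ℝ} (hGm : Measurable G) (hNm : Measurable N)
    (hN : Measure.map N P = gaussianReal 0 1) (hindep : IndepFun G N P) (t : ℝ) :
    charFun (Measure.map (fun ω => √(G ω) * N ω) P) t =
      ∫ g, Complex.exp (-(t ^ 2 * (√g) ^ 2 / 2 : ℝ)) ∂(Measure.map G P) := by
  have hG_prob : IsProbabilityMeasure (Measure.map G P) :=
    Measure.isProbabilityMeasure_map hGm.aemeasurable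
  have hpair := (indepFun_iff_map_prod_eq_prod_map_map hGm.aemeasurable hNm.aemeasurable).1 hindep
  have hcomp : Measure.map (fun ω => √(G ω) * N ω) P =
      Measure.map (fun p : ℝ × ℝ => √p.1 * p.2) ((Measure.map G P).prod (gaussianReal 0 1)) := by
    rw [← hN, ← hpair, Measure.map_map (by fun_prop) (by fun_prop)]
    rfl
  have hmeas : Continuous fun p : ℝ × ℝ =>
      Complex.exp (t * ((√p.1 * p.2 : ℝ) : ℂ) * Complex.I) := by
    fun_prop
  rw [hcomp, charFun_apply_real, integral_map (by fun_prop)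
    (Continuous.aestronglyMeasurable (by fun_prop)), integral_prod]
  · refine integral_congr_ae (.of_forall fun g => ?_)
    have h := charFun_gaussianReal (μ := 0) (v := 1) (t * √g)
    rw [charFun_apply_real] at h
    refine (integral_congr_ae (.of_forall fun n => ?_)).trans (h.trans ?_)
    · push_cast
      ring_nf
    · push_cast
      simp
      ring_nf
  · refine Integrable.of_bound hmeas.aestronglyMeasurable 1 (.of_forall fun p => ?_)
    rw [← Complex.ofReal_mul, Complex.norm_exp_ofReal_mul_I]

/-- The Laplace transform of the exponential distribution. -/
lemma integral_exp_neg_mul_sqrt_sq_expMeasure {l s : ℝ} (hl : 0 < l) (hs : 0 ≤ s) :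
    ∫ g, Complex.exp (-(s * (√g) ^ 2 / 2 : ℝ)) ∂(expMeasure l) = l / (l + s / 2) := by
  have hdens : expMeasure l = volume.withDensity (exponentialPDF l) := rfl
  have hne : (l : ℂ) + s / 2 ≠ 0 := by
    have : l + s / 2 ≠ 0 := by positivity
    exact_mod_cast this
  rw [hdens, integral_withDensity_eq_integral_toReal_smul (by unfold exponentialPDF; fun_prop)
    (.of_forall fun x => by simp [exponentialPDF])]
  have hind : (fun g : ℝ => (exponentialPDF l g).toReal • Complex.exp (-(s * (√g) ^ 2 / 2 : ℝ))) =
      (Set.Ici 0).indicator fun g : ℝ => (l : ℂ) * Complex.exp (-(l + s / 2) * g) := by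
    ext g
    by_cases hg : 0 ≤ g
    · rw [exponentialPDF_of_nonneg hg, ENNReal.toReal_ofReal (by positivity), sq_sqrt hg,
        Set.indicator_of_mem (Set.mem_Ici.2 hg), Complex.real_smul, Complex.ofReal_mul,
        Complex.ofReal_exp, mul_assoc, ← Complex.exp_add]
      push_cast
      ring_nf
    · rw [exponentialPDF_of_neg (not_le.1 hg), Set.indicator_of_notMem (by simpa using hg)]
      simp
  rw [hind, integral_indicator measurableSet_Ici, integral_Ici_eq_integral_Ioi,
    integral_const_mul, integral_exp_mul_complex_Ioi]
  · field_simp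
    simp
  · have : 0 < l + s / 2 := by positivity
    simpa [← Complex.ofReal_ofNat, ← Complex.ofReal_div] using by linarith

lemma integrable_exp_neg_mul_abs {c : ℝ} (hc : 0 < c) :
    Integrable fun x : ℝ => Real.exp (-(c * |x|)) := by
  rw [← integrableOn_univ, ← Set.Iic_union_Ioi (a := (0 : ℝ)), integrableOn_union]
  constructor
  · refine (integrableOn_exp_mul_Iic hc 0).congr_fun (fun x hx => ?_) measurableSet_Iic
    simp [abs_of_nonpos (Set.mem_Iic.1 hx)]
  · refine (integrableOn_exp_mul_Ioi (neg_lt_zero.2 hc) 0).congr_fun (fun x hx => ?_)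
      measurableSet_Ioi
    simp [abs_of_pos (Set.mem_Ioi.1 hx)]

/-- The characteristic function of the Laplace distribution with rate `c`. -/
lemma charFun_withDensity_exp_neg_mul_abs {c : ℝ} (hc : 0 < c) (t : ℝ) :
    charFun (volume.withDensity fun x : ℝ => ENNReal.ofReal (c / 2 * Real.exp (-(c * |x|)))) t =
      c ^ 2 / (c ^ 2 + t ^ 2) := by
  have hplus : (c : ℂ) + t * Complex.I ≠ 0 :=
    fun h => hc.ne' (by simpa using congrArg Complex.re h)
  have hminus : -(c : ℂ) + t * Complex.I ≠ 0 :=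
    fun h => hc.ne' (by simpa using congrArg Complex.re h)
  have hsq : (c : ℂ) ^ 2 + t ^ 2 ≠ 0 := by
    have : c ^ 2 + t ^ 2 ≠ 0 := by positivity
    exact_mod_cast this
  have hint : Integrable fun x : ℝ =>
      (c / 2 * Real.exp (-(c * |x|))) • Complex.exp (t * x * Complex.I) := by
    refine ((integrable_exp_neg_mul_abs hc).const_mul (c / 2)).smul_bdd 1
      (Continuous.aestronglyMeasurable (by fun_prop)) (.of_forall fun x => ?_)
    rw [← Complex.ofReal_mul, Complex.norm_exp_ofReal_mul_I]
  rw [charFun_apply_real, integral_withDensity_eq_integral_toReal_smul (by fun_prop) (by simp)]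
  have htoReal (x : ℝ) : (ENNReal.ofReal (c / 2 * Real.exp (-(c * |x|)))).toReal =
      c / 2 * Real.exp (-(c * |x|)) := ENNReal.toReal_ofReal (by positivity)
  simp only [htoReal]
  have hleft : ∫ x in Set.Iic (0 : ℝ),
      (c / 2 * Real.exp (-(c * |x|))) • Complex.exp (t * x * Complex.I) =
      ∫ x in Set.Iic (0 : ℝ), (c / 2 : ℂ) * Complex.exp ((c + t * Complex.I) * x) := by
    refine setIntegral_congr_fun measurableSet_Iic fun x hx => ?_
    simp only [abs_of_nonpos (Set.mem_Iic.1 hx), Complex.real_smul, Complex.ofReal_mul,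
      Complex.ofReal_exp, mul_assoc, ← Complex.exp_add]
    push_cast
    ring_nf
  have hright : ∫ x in Set.Ioi (0 : ℝ),
      (c / 2 * Real.exp (-(c * |x|))) • Complex.exp (t * x * Complex.I) =
      ∫ x in Set.Ioi (0 : ℝ), (c / 2 : ℂ) * Complex.exp ((-c + t * Complex.I) * x) := by
    refine setIntegral_congr_fun measurableSet_Ioi fun x hx => ?_
    simp only [abs_of_pos (Set.mem_Ioi.1 hx), Complex.real_smul, Complex.ofReal_mul,
      Complex.ofReal_exp, mul_assoc, ← Complex.exp_add]
    push_cast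
    ring_nf
  rw [← intervalIntegral.integral_Iic_add_Ioi hint.integrableOn hint.integrableOn, hleft, hright,
    integral_const_mul, integral_const_mul, integral_exp_mul_complex_Iic (by simpa using hc),
    integral_exp_mul_complex_Ioi (by simpa using hc)]
  simp only [Complex.ofReal_zero, mul_zero, Complex.exp_zero]
  field_simp
  ring_nf
  simp only [Complex.I_sq]
  ring

/-- if `G ∼ Expo(λ)` and `N` standard Gaussian are independent, then
`√G · N` has density `x ↦ (√(2λ)/2) e^{−√(2λ)|x|}` w.r.t. Lebesgue measure; in
particular for `λ = 2` the density is `x ↦ e^{−2|x|}`. -/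
theorem stmt3 {Ω : Type*} [MeasurableSpace Ω] (P : Measure Ω) [IsProbabilityMeasure P]
    (l : ℝ) (hl : 0 < l) (G N : Ω → ℝ) (hGm : Measurable G) (hNm : Measurable N)
    (hG : Measure.map G P = expMeasure l)
    (hN : Measure.map N P = gaussianReal 0 1)
    (hindep : IndepFun G N P) :
    Measure.map (fun ω => Real.sqrt (G ω) * N ω) P =
        volume.withDensity (fun x : ℝ =>
          ENNReal.ofReal (Real.sqrt (2 * l) / 2 * Real.exp (-(Real.sqrt (2 * l) * |x|)))) ∧
      (l = 2 →
        Measure.map (fun ω => Real.sqrt (G ω) * N ω) P =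
          volume.withDensity (fun x : ℝ => ENNReal.ofReal (Real.exp (-(2 * |x|))))) := by
  have hlaw : Measure.map (fun ω => Real.sqrt (G ω) * N ω) P =
      volume.withDensity (fun x : ℝ =>
        ENNReal.ofReal (Real.sqrt (2 * l) / 2 * Real.exp (-(Real.sqrt (2 * l) * |x|)))) := by
    have hc : 0 < √(2 * l) := by positivity
    have hfin := isFiniteMeasure_withDensity_ofReal (μ := volume)
      ((integrable_exp_neg_mul_abs hc).const_mul (√(2 * l) / 2)).2
    have hprob : IsProbabilityMeasure (Measure.map (fun ω => √(G ω) * N ω) P) :=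
      Measure.isProbabilityMeasure_map (by fun_prop)
    refine Measure.ext_of_charFun (funext fun t => ?_)
    rw [charFun_map_sqrt_mul_gaussian hGm hNm hN hindep, hG,
      integral_exp_neg_mul_sqrt_sq_expMeasure hl (sq_nonneg t),
      charFun_withDensity_exp_neg_mul_abs hc, ← Complex.ofReal_pow √(2 * l),
      sq_sqrt (by positivity)]
    have h : l / (l + t ^ 2 / 2) = 2 * l / (2 * l + t ^ 2) := by
      field_simp
    exact_mod_cast h
  refine ⟨hlaw, fun h => ?_⟩
  have hsqrt : √(2 * l) = 2 := by
    rw [h, sqrt_eq_iff_mul_self_eq] <;> norm_num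
  simpa [hsqrt] using hlaw
end

section
/- Let λ > 0, let G be an exponential random variable with rate λ, and let N be a standard Gaussian random variable independent of G. Then √G · |N| is an exponential random variable with rate √(2λ). In particular the exponential distribution with rate 2 is invariant: if G is exponential with rate 2 then √G·|N| is again exponential with rate 2. -/
open MeasureTheory ProbabilityTheory Real

lemma ae_nonneg_expMeasure (r : ℝ) : ∀ᵐ x ∂expMeasure r, 0 ≤ x := by
  have h : {x : ℝ | ¬ 0 ≤ x} = Set.Iio 0 := by ext; simp
  rw [ae_iff, h, expMeasure, gammaMeasure, withDensity_apply _ measurableSet_Iio,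
    lintegral_gammaPDF_of_nonpos le_rfl]

/-- The complex moment generating function of the exponential distribution. -/
lemma integral_cexp_mul_expMeasure {r : ℝ} (hr : 0 < r) {z : ℂ} (hz : z.re < r) :
    ∫ x, Complex.exp (z * x) ∂expMeasure r = r / (r - z) := by
  have hpdf (x : ℝ) : (gammaPDF 1 r x).toReal • Complex.exp (z * x) =
      (Set.Ici 0).indicator (fun x : ℝ ↦ r * Complex.exp ((z - r) * x)) x := by
    change (exponentialPDF r x).toReal • Complex.exp (z * x) = _
    by_cases hx : 0 ≤ x
    · rw [exponentialPDF_of_nonneg hx, ENNReal.toReal_ofReal (by positivity),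
        Set.indicator_of_mem (Set.mem_Ici.2 hx), Complex.real_smul]
      push_cast
      rw [mul_assoc, ← Complex.exp_add]
      ring_nf
    · rw [exponentialPDF_of_neg (not_le.1 hx), Set.indicator_of_notMem (by simpa using hx)]
      simp
  have hzr : (z - r).re < 0 := by simpa using hz
  have hne : z - r ≠ 0 := fun h ↦ by simp [h] at hzr
  have hne' : (r : ℂ) - z ≠ 0 := fun h ↦ hne (by linear_combination -h)
  rw [expMeasure, gammaMeasure, integral_withDensity_eq_integral_toReal_smul (f := gammaPDF 1 r)
    (measurable_gammaPDFReal 1 r).ennreal_ofReal (ae_of_all _ fun _ ↦ ENNReal.ofReal_lt_top)]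
  simp_rw [hpdf]
  rw [integral_indicator measurableSet_Ici, integral_Ici_eq_integral_Ioi, integral_const_mul,
    integral_exp_mul_complex_Ioi hzr]
  simp only [Complex.ofReal_zero, mul_zero, Complex.exp_zero]
  field_simp
  ring

lemma charFun_expMeasure {r : ℝ} (hr : 0 < r) (t : ℝ) :
    charFun (expMeasure r) t = r / (r - t * Complex.I) := by
  rw [charFun_apply_real, ← integral_cexp_mul_expMeasure hr (by simpa using hr)]
  simp_rw [mul_right_comm]

/-- A centred Gaussian whose variance is exponential with rate `l` has the characteristic function
of the Laplace distribution. -/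
lemma charFun_map_sqrt_mul_expMeasure_prod_gaussianReal {l : ℝ} (hl : 0 < l) (t : ℝ) :
    charFun (((expMeasure l).prod (gaussianReal 0 1)).map fun p ↦ √p.1 * p.2) t =
      l / (l + t ^ 2 / 2) := by
  have := isProbabilityMeasure_expMeasure hl
  have hint : Integrable (fun p : ℝ × ℝ ↦ Complex.exp (t * (√p.1 * p.2 : ℝ) * Complex.I))
      ((expMeasure l).prod (gaussianReal 0 1)) := by
    refine Integrable.of_bound (by fun_prop) 1 (ae_of_all _ fun p ↦ ?_)
    rw [← Complex.ofReal_mul, Complex.norm_exp_ofReal_mul_I]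
  rw [charFun_apply_real, integral_map (by fun_prop) (by fun_prop), integral_prod _ hint]
  have hinner (g : ℝ) (hg : 0 ≤ g) :
      ∫ y, Complex.exp (t * (√g * y : ℝ) * Complex.I) ∂gaussianReal 0 1 =
        Complex.exp ((-(t ^ 2 / 2 : ℝ) : ℂ) * g) := by
    have h := charFun_gaussianReal (μ := 0) (v := 1) (√g * t)
    have hsq : (√g : ℂ) ^ 2 = g := by rw [← Complex.ofReal_pow, Real.sq_sqrt hg]
    rw [charFun_apply_real] at h
    convert h using 2
    · ext y
      push_cast
      ring_nf
    · push_cast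
      rw [mul_pow, hsq]
      ring
  rw [integral_congr_ae ((ae_nonneg_expMeasure l).mono hinner), integral_cexp_mul_expMeasure hl]
  · push_cast
    ring
  · rw [← Complex.ofReal_neg, Complex.ofReal_re]
    linarith [sq_nonneg t]

lemma charFun_add_measure {μ ν : Measure ℝ} [IsFiniteMeasure μ] [IsFiniteMeasure ν] (t : ℝ) :
    charFun (μ + ν) t = charFun μ t + charFun ν t := by
  have hint (ρ : Measure ℝ) [IsFiniteMeasure ρ] :
      Integrable (fun x : ℝ ↦ Complex.exp (t * x * Complex.I)) ρ := by
    refine Integrable.of_bound (by fun_prop) 1 (ae_of_all _ fun x ↦ ?_)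
    rw [← Complex.ofReal_mul, Complex.norm_exp_ofReal_mul_I]
  simp_rw [charFun_apply_real]
  exact integral_add_measure (hint μ) (hint ν)

/-- The law of `√G * N` is the Laplace distribution with rate `√(2l)`, that is the symmetrization
of the exponential distribution. -/
lemma map_sqrt_mul_expMeasure_prod_gaussianReal_add_self {l : ℝ} (hl : 0 < l) :
    (((expMeasure l).prod (gaussianReal 0 1)).map fun p ↦ √p.1 * p.2) +
      (((expMeasure l).prod (gaussianReal 0 1)).map fun p ↦ √p.1 * p.2) =
      expMeasure √(2 * l) + (expMeasure √(2 * l)).map ((-1 : ℝ) * ·) := by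
  have hc : 0 < √(2 * l) := Real.sqrt_pos.2 (by positivity)
  have := isProbabilityMeasure_expMeasure hl
  have := isProbabilityMeasure_expMeasure hc
  refine Measure.ext_of_charFun (funext fun t ↦ ?_)
  rw [charFun_add_measure, charFun_add_measure, charFun_map_mul, charFun_expMeasure hc,
    charFun_expMeasure hc, charFun_map_sqrt_mul_expMeasure_prod_gaussianReal hl]
  have hsq : (√(2 * l) : ℂ) ^ 2 = 2 * l := by
    rw [← Complex.ofReal_pow, Real.sq_sqrt (by positivity)]
    push_cast
    rfl
  have h1 : (√(2 * l) : ℂ) - t * Complex.I ≠ 0 :=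
    fun h ↦ hc.ne' (by simpa using congrArg Complex.re h)
  have h2 : (√(2 * l) : ℂ) - (-1 * t : ℝ) * Complex.I ≠ 0 :=
    fun h ↦ hc.ne' (by simpa using congrArg Complex.re h)
  have h3 : (l : ℂ) + t ^ 2 / 2 ≠ 0 := by
    have : (0 : ℝ) < l + t ^ 2 / 2 := by positivity
    exact_mod_cast this.ne'
  rw [div_add_div _ _ h1 h2, div_add_div _ _ h3 h3, div_eq_div_iff (mul_ne_zero h3 h3)
    (mul_ne_zero h1 h2)]
  push_cast
  generalize (√(2 * l) : ℂ) = c at *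
  have hI := Complex.I_sq
  have hl' : (l : ℂ) = c ^ 2 / 2 := by rw [hsq]; ring
  rw [hl']
  linear_combination (-(c ^ 2) * t ^ 2 * (c ^ 2 / 2 + t ^ 2 / 2)) * hI

lemma map_sqrt_mul_abs_expMeasure_prod_gaussianReal {l : ℝ} (hl : 0 < l) :
    ((expMeasure l).prod (gaussianReal 0 1)).map (fun p ↦ √p.1 * |p.2|) =
      expMeasure √(2 * l) := by
  have habs : (expMeasure √(2 * l)).map (fun x ↦ |x|) = expMeasure √(2 * l) := by
    rw [Measure.map_congr ((ae_nonneg_expMeasure _).mono fun x hx ↦ abs_of_nonneg hx)]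
    exact Measure.map_id
  have h := congrArg (Measure.map fun x : ℝ ↦ |x|)
    (map_sqrt_mul_expMeasure_prod_gaussianReal_add_self hl)
  rw [Measure.map_add _ _ (by fun_prop), Measure.map_add _ _ (by fun_prop),
    Measure.map_map (by fun_prop) (by fun_prop), Measure.map_map (by fun_prop) (by fun_prop)] at h
  simp only [Function.comp_def, neg_mul, one_mul, abs_neg, abs_mul,
    abs_of_nonneg (Real.sqrt_nonneg _), habs] at h
  ext s -
  have hs := congrArg (· s) h
  simp only [Measure.add_apply, ← two_mul] at hs
  exact (ENNReal.mul_right_inj two_ne_zero ENNReal.ofNat_ne_top).1 hs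

/-- if `G ∼ Expo(λ)` and `N` standard Gaussian are independent, then
`√G · |N| ∼ Expo(√(2λ))`; in particular, for `λ = 2`, `√G · |N| ∼ Expo(2)`
(the exponential law with rate 2 is invariant). -/
theorem stmt4 {Ω : Type*} [MeasurableSpace Ω] (P : Measure Ω) [IsProbabilityMeasure P]
    (l : ℝ) (hl : 0 < l) (G N : Ω → ℝ) (hGm : Measurable G) (hNm : Measurable N)
    (hG : Measure.map G P = expMeasure l)
    (hN : Measure.map N P = gaussianReal 0 1)
    (hindep : IndepFun G N P) :
    Measure.map (fun ω => Real.sqrt (G ω) * |N ω|) P = expMeasure (Real.sqrt (2 * l)) ∧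
      (l = 2 → Measure.map (fun ω => Real.sqrt (G ω) * |N ω|) P = expMeasure 2) := by
  have hlaw : Measure.map (fun ω => Real.sqrt (G ω) * |N ω|) P =
      expMeasure (Real.sqrt (2 * l)) := by
    rw [← map_sqrt_mul_abs_expMeasure_prod_gaussianReal hl, ← hG, ← hN,
      ← (indepFun_iff_map_prod_eq_prod_map_map hGm.aemeasurable hNm.aemeasurable).1 hindep,
      Measure.map_map (by fun_prop) (by fun_prop)]
    rfl
  refine ⟨hlaw, fun h ↦ ?_⟩
  rw [hlaw, h, Real.sqrt_mul_self zero_le_two]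
end

section
/- Let k ≥ 1 and λ ∈ (0,∞)^k. Then for every x ∈ (0,∞)^k, ∫_{(0,∞)^k} (Π_{i=1}^k λ_i e^{−λ_i g_i}) Ψ_g(x) dg_1⋯dg_k = Σ_{τ ∈ S(0..k)} w_τ(λ) Π_{i=1}^k F_{τ,i}(λ) e^{−F_{τ,i}(λ) x_i}. In words: the gaps operator of iterated Brownian motion sends the product of exponential densities with rates λ_1,…,λ_k to the mixture, with weights w_τ(λ), of the products of exponential densities with rates F_{τ,1}(λ),…,F_{τ,k}(λ). -/
open MeasureTheory ProbabilityTheory Real Finset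

noncomputable section

/-- Density of the centred Gaussian law with variance `g`. -/
def Phi (g y : ℝ) : ℝ := (Real.sqrt (2 * Real.pi * g))⁻¹ * Real.exp (-(y ^ 2) / (2 * g))

/-- Partial sums: `xbar x j = x 0 + ⋯ + x (j-1)` (i.e. `x̄_j`), with `x̄_0 = 0`. -/
def xbar {k : ℕ} (x : Fin k → ℝ) (j : Fin (k + 1)) : ℝ :=
  ∑ i : Fin k, if (i : ℕ) < (j : ℕ) then x i else 0

/-- The density `Ψ_g` of the gaps sequence of iterated Brownian motion. -/
def Psi {k : ℕ} (g x : Fin k → ℝ) : ℝ :=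
  ∑ τ : Equiv.Perm (Fin (k + 1)), ∏ i : Fin k,
    Phi (g i) (xbar x (τ i.succ) - xbar x (τ i.castSucc))

/-- The gaps sequence of a `(k+1)`-tuple of reals. -/
def gaps {k : ℕ} (ℓ : Fin (k + 1) → ℝ) : Fin k → ℝ :=
  fun i => ℓ (Tuple.sort ℓ i.succ) - ℓ (Tuple.sort ℓ i.castSucc)

/-- `E_{τ,i}`: the set of `j ∈ {1,…,k}` with `min(τ(j-1),τ(j)) < i ≤ max(τ(j-1),τ(j))`
(index `j : Fin k` represents `j+1`, `i : Fin k` represents `i+1`). -/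
def Eset {k : ℕ} (τ : Equiv.Perm (Fin (k + 1))) (i : Fin k) : Finset (Fin k) :=
  Finset.univ.filter (fun j : Fin k =>
    min ((τ j.castSucc : Fin (k + 1)) : ℕ) ((τ j.succ : Fin (k + 1)) : ℕ) < (i : ℕ) + 1 ∧
      (i : ℕ) + 1 ≤ max ((τ j.castSucc : Fin (k + 1)) : ℕ) ((τ j.succ : Fin (k + 1)) : ℕ))

/-- `F_{τ,i}(λ) = Σ_{j ∈ E_{τ,i}} √(2 λ_j)`. -/
def F {k : ℕ} (τ : Equiv.Perm (Fin (k + 1))) (i : Fin k) (l : Fin k → ℝ) : ℝ :=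
  ∑ j ∈ Eset τ i, Real.sqrt (2 * l j)

/-- `w_τ(λ) = 2^{-k} Π_i √(2 λ_i) / F_{τ,i}(λ)`. -/
def w {k : ℕ} (τ : Equiv.Perm (Fin (k + 1))) (l : Fin k → ℝ) : ℝ :=
  (2 : ℝ)⁻¹ ^ k * ∏ i : Fin k, Real.sqrt (2 * l i) / F τ i l

lemma tendsto_integral_exp_neg_sq_atTop :
    Filter.Tendsto (fun v : ℝ => ∫ t in (0 : ℝ)..v, Real.exp (-t ^ 2)) Filter.atTop
      (nhds (√π / 2)) := by
  have h := intervalIntegral_tendsto_integral_Ioi (0 : ℝ)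
    ((integrable_exp_neg_mul_sq (b := 1) one_pos).integrableOn (s := Set.Ioi 0)) Filter.tendsto_id
  rw [integral_gaussian_Ioi] at h
  simpa using h

lemma tendsto_integral_exp_neg_sq_atBot :
    Filter.Tendsto (fun v : ℝ => ∫ t in (0 : ℝ)..v, Real.exp (-t ^ 2)) Filter.atBot
      (nhds (-(√π / 2))) := by
  have h := (tendsto_integral_exp_neg_sq_atTop.comp Filter.tendsto_neg_atBot_atTop).neg
  refine h.congr fun v => ?_
  have := intervalIntegral.integral_comp_neg (a := 0) (b := -v) (fun t : ℝ => Real.exp (-t ^ 2))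
  simp only [neg_sq, neg_zero, neg_neg] at this
  simp only [Function.comp_apply]
  rw [this, intervalIntegral.integral_symm, neg_neg]

lemma hasDerivAt_integral_exp_neg_sq (v : ℝ) :
    HasDerivAt (fun v : ℝ => ∫ t in (0 : ℝ)..v, Real.exp (-t ^ 2)) (Real.exp (-v ^ 2)) v :=
  (show Continuous fun t : ℝ => Real.exp (-t ^ 2) by fun_prop).integral_hasStrictDerivAt 0 v
    |>.hasDerivAt

/-- The Laplace-type integral `∫₀^∞ g^{-1/2} exp (-a² g - b² / g) dg = √π / a * exp (-2ab)`. -/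
lemma integral_exp_neg_add_inv_div_sqrt {a b : ℝ} (ha : 0 < a) (hb : 0 < b) :
    ∫ g in Set.Ioi (0 : ℝ), Real.exp (-(a ^ 2 * g + b ^ 2 / g)) / √g =
      √π / a * Real.exp (-(2 * a * b)) := by
  set G : ℝ → ℝ := fun v => ∫ t in (0 : ℝ)..v, Real.exp (-t ^ 2) with hG
  set P : ℝ → ℝ := fun g => a⁻¹ * (Real.exp (2 * a * b) * G (a * √g + b / √g) +
    Real.exp (-(2 * a * b)) * G (a * √g - b / √g)) with hP
  set L : ℝ := a⁻¹ * (Real.exp (2 * a * b) * (√π / 2) +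
    Real.exp (-(2 * a * b)) * (-(√π / 2))) with hL
  have hs0 : Filter.Tendsto (fun g : ℝ => √g) (nhdsWithin 0 (Set.Ioi 0))
      (nhdsWithin 0 (Set.Ioi 0)) := by
    refine tendsto_nhdsWithin_iff.2 ⟨?_, ?_⟩
    · simpa using (Real.continuous_sqrt.tendsto 0).mono_left nhdsWithin_le_nhds
    · filter_upwards [self_mem_nhdsWithin] with g hg using Real.sqrt_pos.2 hg
  have hsi : Filter.Tendsto (fun g : ℝ => a * √g) (nhdsWithin 0 (Set.Ioi 0)) (nhds 0) := by
    simpa using (hs0.mono_right nhdsWithin_le_nhds).const_mul a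
  have hbi : Filter.Tendsto (fun g : ℝ => b / √g) (nhdsWithin 0 (Set.Ioi 0)) Filter.atTop := by
    simpa [div_eq_mul_inv] using (tendsto_inv_nhdsGT_zero.comp hs0).const_mul_atTop hb
  have hs1 : Filter.Tendsto (fun g : ℝ => a * √g) Filter.atTop Filter.atTop :=
    Real.tendsto_sqrt_atTop.const_mul_atTop ha
  have hb1 : Filter.Tendsto (fun g : ℝ => b / √g) Filter.atTop (nhds 0) :=
    Real.tendsto_sqrt_atTop.const_div_atTop b
  have hP0 : Filter.Tendsto P (nhdsWithin 0 (Set.Ioi 0)) (nhds L) := by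
    refine Filter.Tendsto.const_mul _ (Filter.Tendsto.add (Filter.Tendsto.const_mul _ ?_)
      (Filter.Tendsto.const_mul _ ?_))
    · exact tendsto_integral_exp_neg_sq_atTop.comp (hsi.add_atTop hbi)
    · refine tendsto_integral_exp_neg_sq_atBot.comp ?_
      simpa only [sub_eq_add_neg, Function.comp_apply] using
        hsi.add_atBot (Filter.tendsto_neg_atTop_atBot.comp hbi)
  have hP1 : Filter.Tendsto P Filter.atTop (nhds (a⁻¹ * (Real.exp (2 * a * b) * (√π / 2) +
      Real.exp (-(2 * a * b)) * (√π / 2)))) := by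
    refine Filter.Tendsto.const_mul _ (Filter.Tendsto.add (Filter.Tendsto.const_mul _ ?_)
      (Filter.Tendsto.const_mul _ ?_))
    · exact tendsto_integral_exp_neg_sq_atTop.comp (hs1.atTop_add hb1)
    · refine tendsto_integral_exp_neg_sq_atTop.comp ?_
      simpa only [sub_eq_add_neg] using hs1.atTop_add hb1.neg
  have hderiv : ∀ g ∈ Set.Ioi (0 : ℝ),
      HasDerivAt P (Real.exp (-(a ^ 2 * g + b ^ 2 / g)) / √g) g := by
    intro g hg
    have hg' : (0 : ℝ) < g := hg
    have hr : 0 < √g := Real.sqrt_pos.2 hg'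
    have hsq : √g ^ 2 = g := Real.sq_sqrt hg'.le
    have h1 : HasDerivAt (fun g : ℝ => √g) (1 / (2 * √g)) g := Real.hasDerivAt_sqrt hg'.ne'
    have h2 := h1.const_mul a
    have h3 := (h1.fun_inv hr.ne').const_mul b
    simp only [← div_eq_mul_inv] at h3
    have h4 := (hasDerivAt_integral_exp_neg_sq _).comp g (h2.fun_add h3)
    have h5 := (hasDerivAt_integral_exp_neg_sq _).comp g (h2.fun_sub h3)
    have h6 := ((h4.const_mul (Real.exp (2 * a * b))).fun_add
      (h5.const_mul (Real.exp (-(2 * a * b))))).const_mul a⁻¹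
    refine h6.congr_deriv ?_
    have e1 : Real.exp (-(a * √g + b / √g) ^ 2) =
        Real.exp (-(2 * a * b)) * Real.exp (-(a ^ 2 * g + b ^ 2 / g)) := by
      rw [← Real.exp_add]
      congr 1
      rw [← hsq, Real.sqrt_sq hr.le]
      field_simp
      ring
    have e2 : Real.exp (-(a * √g - b / √g) ^ 2) =
        Real.exp (2 * a * b) * Real.exp (-(a ^ 2 * g + b ^ 2 / g)) := by
      rw [← Real.exp_add]
      congr 1
      rw [← hsq, Real.sqrt_sq hr.le]
      field_simp
      ring
    rw [e1, e2, Real.exp_neg (2 * a * b)]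
    have := Real.exp_pos (2 * a * b)
    field_simp
    ring
  have hupd : ∀ g ∈ Set.Ioi (0 : ℝ), Function.update P 0 L =ᶠ[nhds g] P := by
    intro g hg
    filter_upwards [isOpen_Ioi.mem_nhds hg] with t ht
    exact Function.update_of_ne (ne_of_gt ht) _ _
  have key := integral_Ioi_of_hasDerivAt_of_nonneg (a := 0) (g := Function.update P 0 L)
    (g' := fun g => Real.exp (-(a ^ 2 * g + b ^ 2 / g)) / √g) ?_
    (fun g hg => (hderiv g hg).congr_of_eventuallyEq (hupd g hg)) (fun g _ => by positivity)
    (hP1.congr' (by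
      filter_upwards [Filter.Ioi_mem_atTop (0 : ℝ)] with t ht
      exact (Function.update_of_ne (ne_of_gt ht) _ _).symm))
  · rw [key, Function.update_self, hL]
    field_simp
    ring
  · rw [continuousWithinAt_update_same]
    simpa using hP0

lemma integral_exponential_mul_Phi {l y : ℝ} (hl : 0 < l) (hy : y ≠ 0) :
    ∫ g in Set.Ioi (0 : ℝ), l * Real.exp (-(l * g)) * Phi g y =
      √(2 * l) / 2 * Real.exp (-(√(2 * l) * |y|)) := by
  have h2 : 0 < √(2 : ℝ) := by positivity
  have hpi : 0 < √π := Real.sqrt_pos.2 Real.pi_pos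
  have h22 : √(2 : ℝ) ^ 2 = 2 := Real.sq_sqrt (by norm_num)
  have hl2 : √l ^ 2 = l := Real.sq_sqrt hl.le
  have hls : 0 < √l := Real.sqrt_pos.2 hl
  have h := integral_exp_neg_add_inv_div_sqrt hls (div_pos (abs_pos.2 hy) h2)
  have hc : ∀ g ∈ Set.Ioi (0 : ℝ), l * Real.exp (-(l * g)) * Phi g y =
      l / (√2 * √π) * (Real.exp (-(√l ^ 2 * g + (|y| / √2) ^ 2 / g)) / √g) := by
    intro g hg
    have hg' : (0 : ℝ) < g := hg
    have hgs : 0 < √g := Real.sqrt_pos.2 hg'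
    rw [Phi, Real.sqrt_mul (by positivity), Real.sqrt_mul (by norm_num), hl2, div_pow, h22, sq_abs,
      neg_add, Real.exp_add, show -(y ^ 2) / (2 * g) = -(y ^ 2 / 2 / g) by field_simp]
    field_simp
  rw [setIntegral_congr_fun measurableSet_Ioi hc, integral_const_mul, h,
    Real.sqrt_mul (by norm_num),
    show 2 * √l * (|y| / √2) = √2 * √l * |y| by field_simp; rw [h22]]
  field_simp
  rw [h22, hl2, mul_comm]

lemma integrableOn_exponential_mul_Phi {l y : ℝ} (hl : 0 < l) (hy : y ≠ 0) :
    IntegrableOn (fun g => l * Real.exp (-(l * g)) * Phi g y) (Set.Ioi 0) := by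
  refine Integrable.of_integral_ne_zero ?_
  rw [integral_exponential_mul_Phi hl hy]
  positivity

lemma abs_xbar_sub {k : ℕ} {x : Fin k → ℝ} (hx : ∀ i, 0 ≤ x i) (a b : Fin (k + 1)) :
    |xbar x b - xbar x a| = ∑ i : Fin k,
      if min (a : ℕ) b < (i : ℕ) + 1 ∧ (i : ℕ) + 1 ≤ max (a : ℕ) b then x i else 0 := by
  wlog hab : a ≤ b generalizing a b
  · rw [abs_sub_comm, this b a (le_of_not_ge hab), min_comm, max_comm]
  have hab' : (a : ℕ) ≤ b := hab
  rw [min_eq_left hab', max_eq_right hab']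
  have : xbar x b - xbar x a = ∑ i : Fin k,
      if (a : ℕ) < (i : ℕ) + 1 ∧ (i : ℕ) + 1 ≤ (b : ℕ) then x i else 0 := by
    rw [xbar, xbar, ← Finset.sum_sub_distrib]
    refine Finset.sum_congr rfl fun i _ => ?_
    split_ifs <;> first | omega | simp
  rw [this, abs_of_nonneg]
  exact Finset.sum_nonneg fun i _ => by split_ifs <;> simp [hx]

lemma xbar_strictMono {k : ℕ} {x : Fin k → ℝ} (hx : ∀ i, 0 < x i) : StrictMono (xbar x) := by
  refine Fin.strictMono_iff_lt_succ.2 fun i => ?_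
  refine Finset.sum_lt_sum (fun j _ => ?_) ⟨i, Finset.mem_univ _, by simp [hx]⟩
  simp only [Fin.val_castSucc, Fin.val_succ]
  split_ifs <;> first | omega | exact le_rfl | exact (hx j).le

lemma Eset_nonempty {k : ℕ} (τ : Equiv.Perm (Fin (k + 1))) (i : Fin k) : (Eset τ i).Nonempty := by
  by_contra hne
  have hstep : ∀ j : Fin k, ((τ j.castSucc : ℕ) ≤ i ↔ (τ j.succ : ℕ) ≤ i) := by
    intro j
    have hj : j ∉ Eset τ i := by simp [Finset.not_nonempty_iff_eq_empty.1 hne]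
    simp only [Eset, Finset.mem_filter, Finset.mem_univ, true_and] at hj
    omega
  have hall : ∀ j : Fin (k + 1), ((τ j : ℕ) ≤ i ↔ (τ 0 : ℕ) ≤ i) := by
    intro j
    induction j using Fin.induction with
    | zero => rfl
    | succ j ih => rw [← hstep j, ih]
  have h0 := hall (τ.symm 0)
  have h1 := hall (τ.symm (Fin.last k))
  simp only [Equiv.apply_symm_apply, Fin.val_zero, Fin.val_last] at h0 h1
  omega

lemma F_pos {k : ℕ} (τ : Equiv.Perm (Fin (k + 1))) (i : Fin k) {l : Fin k → ℝ}
    (hl : ∀ j, 0 < l j) : 0 < F τ i l :=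
  Finset.sum_pos (fun j _ => Real.sqrt_pos.2 (mul_pos two_pos (hl j))) (Eset_nonempty τ i)

lemma sum_sqrt_mul_abs_xbar_sub {k : ℕ} (τ : Equiv.Perm (Fin (k + 1))) (l : Fin k → ℝ)
    {x : Fin k → ℝ} (hx : ∀ i, 0 ≤ x i) :
    ∑ j : Fin k, √(2 * l j) * |xbar x (τ j.succ) - xbar x (τ j.castSucc)| =
      ∑ i : Fin k, F τ i l * x i := by
  simp only [abs_xbar_sub hx, F, Eset, Finset.sum_filter, Finset.mul_sum, Finset.sum_mul]
  rw [Finset.sum_comm]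
  refine Finset.sum_congr rfl fun i _ => Finset.sum_congr rfl fun j _ => ?_
  split_ifs <;> simp

/-- the gaps operator of iterated Brownian motion sends the product of
exponential densities with rates `λ_1,…,λ_k` to the mixture, with weights `w_τ(λ)`,
of products of exponential densities with rates `F_{τ,1}(λ),…,F_{τ,k}(λ)`. -/
theorem stmt5 {k : ℕ} (hk : 1 ≤ k) (l : Fin k → ℝ) (hl : ∀ i, 0 < l i)
    (x : Fin k → ℝ) (hx : ∀ i, 0 < x i) :
    ∫ g in {g : Fin k → ℝ | ∀ i, 0 < g i},
        (∏ i : Fin k, l i * Real.exp (-(l i * g i))) * Psi g x =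
      ∑ τ : Equiv.Perm (Fin (k + 1)),
        w τ l * ∏ i : Fin k, F τ i l * Real.exp (-(F τ i l * x i)) := by
  have hset : {g : Fin k → ℝ | ∀ i, 0 < g i} = Set.univ.pi fun _ => Set.Ioi 0 := by
    ext g
    simp
  have hmeas : (volume : Measure (Fin k → ℝ)).restrict {g | ∀ i, 0 < g i} =
      Measure.pi fun _ => (volume : Measure ℝ).restrict (Set.Ioi 0) := by
    rw [hset, volume_pi, Measure.restrict_pi_pi]
  have hne : ∀ (τ : Equiv.Perm (Fin (k + 1))) (i : Fin k),
      xbar x (τ i.succ) - xbar x (τ i.castSucc) ≠ 0 := by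
    intro τ i h
    have := τ.injective ((xbar_strictMono hx).injective (sub_eq_zero.1 h))
    exact (Fin.castSucc_lt_succ (i := i)).ne' this
  simp only [Psi, Finset.mul_sum, ← Finset.prod_mul_distrib, hmeas]
  rw [integral_finsetSum _ fun τ _ => Integrable.fintype_prod fun i =>
    integrableOn_exponential_mul_Phi (hl i) (hne τ i)]
  refine Finset.sum_congr rfl fun τ _ => ?_
  rw [integral_fintype_prod_eq_prod (fun i g => l i * Real.exp (-(l i * g)) *
    Phi g (xbar x (τ i.succ) - xbar x (τ i.castSucc)))]
  simp only [integral_exponential_mul_Phi (hl _) (hne τ _)]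
  have hF : ∏ i, F τ i l ≠ 0 := Finset.prod_ne_zero_iff.2 fun i _ => (F_pos τ i hl).ne'
  rw [w, Finset.prod_mul_distrib, ← Real.exp_sum, Finset.sum_neg_distrib,
    sum_sqrt_mul_abs_xbar_sub τ l fun i => (hx i).le, Finset.prod_mul_distrib, ← Real.exp_sum,
    Finset.sum_neg_distrib, Finset.prod_div_distrib, Finset.prod_div_distrib, Finset.prod_const,
    Finset.card_univ, Fintype.card_fin, inv_pow]
  field_simp
end
end

section
/- Let k ≥ 1. For every λ ∈ (0,∞)^k, Σ_{τ ∈ S(0..k)} w_τ(λ) = 1; that is, the weights w_τ(λ) form a probability vector on the set of permutations of {0,1,…,k}. -/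
open MeasureTheory ProbabilityTheory Real Finset

noncomputable section

/-- Insert a last entry of value `r` into the permutation `σ`, shifting the values at least `r`. -/
def insertLast {n : ℕ} (r : Fin (n + 1)) (σ : Equiv.Perm (Fin n)) : Equiv.Perm (Fin (n + 1)) :=
  ((finSuccEquiv' (Fin.last n)).trans (Equiv.optionCongr σ)).trans (finSuccEquiv' r).symm

theorem insertLast_last {n : ℕ} (r : Fin (n + 1)) (σ : Equiv.Perm (Fin n)) :
    insertLast r σ (Fin.last n) = r := by
  simp [insertLast]

theorem insertLast_castSucc {n : ℕ} (r : Fin (n + 1)) (σ : Equiv.Perm (Fin n)) (v : Fin n) :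
    insertLast r σ v.castSucc = r.succAbove (σ v) := by
  have h : finSuccEquiv' (Fin.last n) v.castSucc = some v := by
    rw [← Fin.succAbove_last_apply, finSuccEquiv'_succAbove]
  simp [insertLast, h]

theorem insertLast_bijective (n : ℕ) :
    Function.Bijective
      (fun x : Fin (n + 1) × Equiv.Perm (Fin n) => insertLast x.1 x.2) := by
  rw [Fintype.bijective_iff_injective_and_card]
  constructor
  · rintro ⟨r, σ⟩ ⟨r', σ'⟩ h
    dsimp only at h
    have hr : r = r' := by rw [← insertLast_last r σ, h, insertLast_last]
    subst hr
    congr 1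
    ext v : 1
    apply Fin.succAbove_right_injective (p := r)
    rw [← insertLast_castSucc, h, insertLast_castSucc]
  · simp [Fintype.card_perm, Nat.factorial_succ]

/-- Total cost of the steps of the path `h` that cross from below `n` to at least `n`
or conversely, the step `j` having cost `c j`. -/
def crossingSum {k : ℕ} (c : Fin k → ℝ) (h : Fin (k + 1) → ℕ) (n : ℕ) : ℝ :=
  ∑ j : Fin k, if n ≤ h j.castSucc ↔ n ≤ h j.succ then 0 else c j

theorem crossingSum_eq_zero {k : ℕ} (c : Fin k → ℝ) {h : Fin (k + 1) → ℕ} {n : ℕ}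
    (H : ∀ v w, n ≤ h v ↔ n ≤ h w) : crossingSum c h n = 0 :=
  Finset.sum_eq_zero fun _ _ => if_pos (H _ _)

theorem crossingSum_pos {k : ℕ} {c : Fin k → ℝ} (hc : ∀ j, 0 < c j) {h : Fin (k + 1) → ℕ}
    {n : ℕ} {v w : Fin (k + 1)} (hv : h v < n) (hw : n ≤ h w) : 0 < crossingSum c h n := by
  have hnn : ∀ j ∈ Finset.univ,
      0 ≤ if n ≤ h (Fin.castSucc j) ↔ n ≤ h (Fin.succ j) then 0 else c j := by
    intro j _
    split_ifs
    exacts [le_rfl, (hc j).le]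
  refine (Finset.sum_nonneg hnn).lt_of_ne' fun h0 => ?_
  rw [Finset.sum_eq_zero_iff_of_nonneg hnn] at h0
  have hstep : ∀ j : Fin k, n ≤ h j.castSucc ↔ n ≤ h j.succ := by
    intro j
    by_contra hj
    have := h0 j (Finset.mem_univ j)
    rw [if_neg hj] at this
    exact (hc j).ne' this
  have hall : ∀ u : Fin (k + 1), n ≤ h u ↔ n ≤ h 0 := by
    intro u
    induction u using Fin.induction with
    | zero => rfl
    | succ j ih => rw [← hstep j, ih]
  have := (hall v).2 ((hall w).1 hw)
  omega

theorem le_succAbove_iff {m : ℕ} (r : Fin (m + 1)) (v : Fin m) (n : ℕ) :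
    n ≤ (r.succAbove v : ℕ) ↔ (if n ≤ (r : ℕ) then n else n - 1) ≤ (v : ℕ) := by
  by_cases hv : v.castSucc < r
  · rw [Fin.succAbove_of_castSucc_lt _ _ hv]
    rw [Fin.lt_def] at hv
    simp only [Fin.val_castSucc] at hv ⊢
    split_ifs <;> omega
  · rw [Fin.succAbove_of_le_castSucc _ _ (not_lt.1 hv)]
    rw [Fin.lt_def] at hv
    simp only [Fin.val_castSucc, Fin.val_succ] at hv ⊢
    split_ifs <;> omega

theorem crossingSum_insertLast {k : ℕ} (c : Fin (k + 1) → ℝ) (r : Fin (k + 2))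
    (σ : Equiv.Perm (Fin (k + 1))) (n : ℕ) :
    crossingSum c (fun v => (insertLast r σ v : ℕ)) n =
      if n ≤ (r : ℕ) then
        crossingSum (fun j => c j.castSucc) (fun v => (σ v : ℕ)) n +
          if n ≤ (σ (Fin.last k) : ℕ) then 0 else c (Fin.last k)
      else
        crossingSum (fun j => c j.castSucc) (fun v => (σ v : ℕ)) (n - 1) +
          if n - 1 ≤ (σ (Fin.last k) : ℕ) then c (Fin.last k) else 0 := by
  unfold crossingSum
  rw [Fin.sum_univ_castSucc]
  simp only [Fin.succ_last, Fin.succ_castSucc, insertLast_castSucc, insertLast_last,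
    le_succAbove_iff]
  by_cases hn : n ≤ (r : ℕ) <;> simp only [hn, if_true, if_false, iff_true, iff_false, ite_not]

/-- Telescoping: `G n + c` and `G n` are the two possible costs of a level. -/
theorem sum_prod_inv_insert {k p : ℕ} (hp : p ≤ k) {c : ℝ} (hc : 0 < c) {G : ℕ → ℝ}
    (h0 : G 0 = 0) (hlast : G (k + 1) = 0) (hG : ∀ n, 1 ≤ n → n ≤ k → 0 < G n) :
    ∑ r ∈ Finset.range (k + 2),
      (∏ n ∈ Finset.Ico 1 (r + 1), (G n + if n ≤ p then 0 else c)⁻¹) *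
        ∏ m ∈ Finset.Ico r (k + 1), (G m + if m ≤ p then c else 0)⁻¹ =
      2 / c * ∏ n ∈ Finset.Ico 1 (k + 1), (G n)⁻¹ := by
  set U : ℕ → ℝ := fun r => ∏ n ∈ Finset.Ico 1 (r + 1), (G n + if n ≤ p then 0 else c)⁻¹ with hU
  set V : ℕ → ℝ := fun r => ∏ m ∈ Finset.Ico r (k + 1), (G m + if m ≤ p then c else 0)⁻¹ with hV
  change ∑ r ∈ Finset.range (k + 2), U r * V r = _
  have hUs : ∀ r, U (r + 1) = U r * (G (r + 1) + if r + 1 ≤ p then 0 else c)⁻¹ := fun r =>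
    Finset.prod_Ico_succ_top (by omega) _
  have hVs : ∀ r, r ≤ k → V r = (G r + if r ≤ p then c else 0)⁻¹ * V (r + 1) := fun r hr =>
    Finset.prod_eq_prod_Ico_succ_bot (by omega) _
  have hD : U p * V (p + 1) = ∏ n ∈ Finset.Ico 1 (k + 1), (G n)⁻¹ := by
    rw [← Finset.prod_Ico_consecutive _ (by omega : 1 ≤ p + 1) (by omega : p + 1 ≤ k + 1)]
    congr 1
    · refine Finset.prod_congr rfl fun n hn => ?_
      rw [if_pos (by have := Finset.mem_Ico.1 hn; omega), add_zero]
    · refine Finset.prod_congr rfl fun n hn => ?_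
      rw [if_neg (by have := Finset.mem_Ico.1 hn; omega), add_zero]
  have hlow : ∀ r, r ≤ p → ∑ s ∈ Finset.range (r + 1), U s * V s = c⁻¹ * (U r * V (r + 1)) := by
    intro r
    induction r with
    | zero =>
      intro _
      rw [zero_add, Finset.sum_range_one, hVs 0 (by omega), h0, if_pos (by omega)]
      ring
    | succ r ih =>
      intro hr
      have hpos := hG (r + 1) (by omega) (by omega)
      rw [Finset.sum_range_succ, ih (by omega), hUs, hVs (r + 1) (by omega), if_pos hr, if_pos hr]
      field_simp
      ring
  have hhigh : ∀ r, p ≤ r → r ≤ k → ∑ s ∈ Finset.range (r + 1), U s * V s =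
      c⁻¹ * (2 * (U p * V (p + 1)) - U r * V (r + 1)) := by
    intro r hr
    induction r, hr using Nat.le_induction with
    | base =>
      intro _
      rw [hlow p le_rfl]
      ring
    | succ r hr ih =>
      intro hk
      have hpos := hG (r + 1) (by omega) hk
      rw [Finset.sum_range_succ, ih (by omega), hUs, hVs (r + 1) hk, if_neg (by omega),
        if_neg (by omega)]
      field_simp
      ring
  have hV1 : V (k + 1) = 1 := by simp [hV]
  rw [Finset.sum_range_succ, hhigh k hp le_rfl, hUs, hlast, if_neg (by omega), hV1, hD]
  ring

theorem prod_crossingSum_insertLast {k : ℕ} (c : Fin (k + 1) → ℝ) (r : Fin (k + 2))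
    (σ : Equiv.Perm (Fin (k + 1))) :
    ∏ n ∈ Finset.Ico 1 (k + 2), (crossingSum c (fun v => (insertLast r σ v : ℕ)) n)⁻¹ =
      (∏ n ∈ Finset.Ico 1 ((r : ℕ) + 1),
        (crossingSum (fun j => c j.castSucc) (fun v => (σ v : ℕ)) n +
          if n ≤ (σ (Fin.last k) : ℕ) then 0 else c (Fin.last k))⁻¹) *
      ∏ m ∈ Finset.Ico (r : ℕ) (k + 1),
        (crossingSum (fun j => c j.castSucc) (fun v => (σ v : ℕ)) m +
          if m ≤ (σ (Fin.last k) : ℕ) then c (Fin.last k) else 0)⁻¹ := by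
  rw [← Finset.prod_Ico_consecutive _ (by omega : 1 ≤ (r : ℕ) + 1)
    (by omega : (r : ℕ) + 1 ≤ k + 2)]
  congr 1
  · refine Finset.prod_congr rfl fun n hn => ?_
    rw [crossingSum_insertLast, if_pos (by have := Finset.mem_Ico.1 hn; omega)]
  · rw [← Finset.prod_Ico_add' _ (r : ℕ) (k + 1) 1]
    refine Finset.prod_congr rfl fun n hn => ?_
    rw [crossingSum_insertLast, if_neg (by have := Finset.mem_Ico.1 hn; omega),
      Nat.add_sub_cancel]

theorem sum_perm_prod_crossingSum {k : ℕ} (c : Fin k → ℝ) (hc : ∀ j, 0 < c j) :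
    ∑ τ : Equiv.Perm (Fin (k + 1)),
      ∏ n ∈ Finset.Ico 1 (k + 1), (crossingSum c (fun v => (τ v : ℕ)) n)⁻¹ =
      ∏ j, 2 / c j := by
  induction k with
  | zero => simp
  | succ k ih =>
    rw [← (insertLast_bijective (k + 1)).sum_comp, Fintype.sum_prod_type, Finset.sum_comm,
      Fin.prod_univ_castSucc, ← ih (fun j => c j.castSucc) fun j => hc _, Finset.sum_mul]
    refine Finset.sum_congr rfl fun σ _ => ?_
    simp only [prod_crossingSum_insertLast]
    rw [Fin.sum_univ_eq_sum_range (fun r : ℕ =>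
      (∏ n ∈ Finset.Ico 1 (r + 1),
        (crossingSum (fun j => c j.castSucc) (fun v => (σ v : ℕ)) n +
          if n ≤ (σ (Fin.last k) : ℕ) then 0 else c (Fin.last k))⁻¹) *
      ∏ m ∈ Finset.Ico r (k + 1),
        (crossingSum (fun j => c j.castSucc) (fun v => (σ v : ℕ)) m +
          if m ≤ (σ (Fin.last k) : ℕ) then c (Fin.last k) else 0)⁻¹) (k + 2),
      sum_prod_inv_insert (by omega) (hc _), mul_comm]
    · exact crossingSum_eq_zero _ fun v w => by simp
    · exact crossingSum_eq_zero _ fun v w => by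
        have := (σ v).isLt
        have := (σ w).isLt
        omega
    · intro n h1 hk
      refine crossingSum_pos (fun j => hc _) (v := σ.symm 0) (w := σ.symm (Fin.last k)) ?_ ?_
      · simpa using Nat.lt_of_lt_of_le Nat.zero_lt_one h1
      · simpa using hk

theorem F_eq_crossingSum {k : ℕ} (τ : Equiv.Perm (Fin (k + 1))) (i : Fin k) (l : Fin k → ℝ) :
    F τ i l = crossingSum (fun j => √(2 * l j)) (fun v => (τ v : ℕ)) ((i : ℕ) + 1) := by
  unfold F Eset crossingSum
  rw [Finset.sum_filter]
  refine Finset.sum_congr rfl fun j _ => ?_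
  rw [← ite_not]
  refine if_congr ?_ rfl rfl
  dsimp only
  omega

/-- the weights `w_τ(λ)` form a probability vector on `S(0..k)`. -/
theorem stmt6 {k : ℕ} (hk : 1 ≤ k) (l : Fin k → ℝ) (hl : ∀ i, 0 < l i) :
    ∑ τ : Equiv.Perm (Fin (k + 1)), w τ l = 1 := by
  have hc : ∀ j, 0 < √(2 * l j) := fun j => Real.sqrt_pos.2 (by linarith [hl j])
  have hw : ∀ τ : Equiv.Perm (Fin (k + 1)), w τ l = ((2 : ℝ)⁻¹ ^ k * ∏ i, √(2 * l i)) *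
      ∏ n ∈ Finset.Ico 1 (k + 1),
        (crossingSum (fun j => √(2 * l j)) (fun v => (τ v : ℕ)) n)⁻¹ := by
    intro τ
    unfold w
    simp only [F_eq_crossingSum, div_eq_mul_inv]
    rw [Finset.prod_mul_distrib, ← mul_assoc]
    congr 1
    rw [← Finset.prod_Ico_add' _ 0 k 1, ← Finset.range_eq_Ico, Finset.prod_range]
  have hP : ∏ i, √(2 * l i) ≠ 0 := Finset.prod_ne_zero_iff.2 fun j _ => (hc j).ne'
  simp only [hw]
  rw [← Finset.mul_sum, sum_perm_prod_crossingSum _ hc, Finset.prod_div_distrib,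
    Finset.prod_const, Finset.card_univ, Fintype.card_fin, inv_pow]
  field_simp
end
end

section
/- Let k ≥ 1 and let ν, ν′ be probability measures on (0,∞)^k such that f_ν(x) = f_{ν′}(x) for every x ∈ (0,∞)^k. Then ν = ν′. In other words, a mixture of products of exponential densities possesses a unique parameter law. -/
open MeasureTheory ProbabilityTheory Real Finset

noncomputable section

/-- The mixture of products of exponential densities with parameter law `ν`:
`f_ν(x) = ∫ Π_i λ_i e^{−λ_i x_i} dν(λ)`. -/
def fmix {k : ℕ} (ν : Measure (Fin k → ℝ)) (x : Fin k → ℝ) : ℝ :=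
  ∫ l, ∏ i : Fin k, l i * Real.exp (-(l i * x i)) ∂ν

open scoped NNReal ENNReal BoundedContinuousFunction

section LaplaceTransform

variable {ι : Type*} [Fintype ι]

/-- The multiplicative family `l ↦ exp (-∑ i, n i * l i)`, `n : ι → ℕ`, of bounded continuous
functions on the nonnegative orthant. -/
def expNegDot (ι : Type*) [Fintype ι] : Multiplicative (ι → ℕ) →* ((ι → ℝ≥0) →ᵇ ℝ) where
  toFun n := BoundedContinuousFunction.ofNormedAddCommGroup
    (fun l => Real.exp (-∑ i, (n.toAdd i : ℝ) * (l i : ℝ))) (by fun_prop) 1 (fun l => by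
      rw [Real.norm_eq_abs, Real.abs_exp, Real.exp_le_one_iff, neg_nonpos]
      positivity)
  map_one' := by
    ext l
    simp
  map_mul' m n := by
    ext l
    simp [← Real.exp_add, add_mul, Finset.sum_add_distrib, add_comm]

lemma expNegDot_apply (n : Multiplicative (ι → ℕ)) (l : ι → ℝ≥0) :
    expNegDot ι n l = Real.exp (-∑ i, (n.toAdd i : ℝ) * (l i : ℝ)) := rfl

/-- A finite measure on the nonnegative orthant is determined by the values of its Laplace
transform at the points with natural coordinates. -/
theorem ext_of_integral_exp_neg_nnreal {P P' : Measure (ι → ℝ≥0)} [IsFiniteMeasure P]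
    [IsFiniteMeasure P']
    (h : ∀ n : ι → ℕ, ∫ l, Real.exp (-∑ i, (n i : ℝ) * (l i : ℝ)) ∂P =
      ∫ l, Real.exp (-∑ i, (n i : ℝ) * (l i : ℝ)) ∂P') : P = P' := by
  classical
  let A : StarSubalgebra ℝ ((ι → ℝ≥0) →ᵇ ℝ) :=
    { Algebra.adjoin ℝ (MonoidHom.mrange (expNegDot ι) : Set ((ι → ℝ≥0) →ᵇ ℝ)) with
      star_mem' := fun {f} hf => by
        have hstar : star f = f := by ext; simp
        rw [hstar]
        exact hf }
  have hmem (n : Multiplicative (ι → ℕ)) : expNegDot ι n ∈ A :=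
    Algebra.subset_adjoin ⟨n, rfl⟩
  refine ext_of_forall_mem_subalgebra_integral_eq_of_polish (A := A) ?_ ?_
  · intro x y hxy
    obtain ⟨i, hi⟩ := Function.ne_iff.mp hxy
    refine ⟨_, ⟨_, ⟨_, hmem (Multiplicative.ofAdd (Pi.single i 1)), rfl⟩, rfl⟩, ?_⟩
    simpa [expNegDot_apply, Pi.single_apply] using hi
  · intro g hg
    have hg' : g ∈ Submodule.span ℝ
        (MonoidHom.mrange (expNegDot ι) : Set ((ι → ℝ≥0) →ᵇ ℝ)) := by
      have := Algebra.adjoin_eq_span ℝ (MonoidHom.mrange (expNegDot ι) : Set ((ι → ℝ≥0) →ᵇ ℝ))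
      rw [Submonoid.closure_eq] at this
      rw [← this]
      exact hg
    clear hg
    induction hg' using Submodule.span_induction with
    | mem f hf =>
      obtain ⟨n, rfl⟩ := hf
      exact h n.toAdd
    | zero => simp
    | add f g _ _ hf hg =>
      have hadd (Q : Measure (ι → ℝ≥0)) [IsFiniteMeasure Q] :
          ∫ l, (f + g) l ∂Q = ∫ l, f l ∂Q + ∫ l, g l ∂Q :=
        integral_add (f.integrable Q) (g.integrable Q)
      rw [hadd, hadd, hf, hg]
    | smul c f _ hf =>
      have hsmul (Q : Measure (ι → ℝ≥0)) : ∫ l, (c • f) l ∂Q = c • ∫ l, f l ∂Q :=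
        integral_smul c f
      rw [hsmul, hsmul, hf]

/-- A finite measure concentrated on the nonnegative orthant is determined by the values of its
Laplace transform at the points with natural coordinates. -/
theorem ext_of_integral_exp_neg {P P' : Measure (ι → ℝ)} [IsFiniteMeasure P]
    [IsFiniteMeasure P'] (hP : ∀ᵐ l ∂P, ∀ i, 0 ≤ l i) (hP' : ∀ᵐ l ∂P', ∀ i, 0 ≤ l i)
    (h : ∀ n : ι → ℕ, ∫ l, Real.exp (-∑ i, (n i : ℝ) * l i) ∂P =
      ∫ l, Real.exp (-∑ i, (n i : ℝ) * l i) ∂P') : P = P' := by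
  let φ : (ι → ℝ) → ι → ℝ≥0 := fun l i => (l i).toNNReal
  let ψ : (ι → ℝ≥0) → ι → ℝ := fun l i => l i
  have hφ : Measurable φ := by fun_prop
  have hψ : Measurable ψ := by fun_prop
  have map_map_self {Q : Measure (ι → ℝ)} (hQ : ∀ᵐ l ∂Q, ∀ i, 0 ≤ l i) :
      (Q.map φ).map ψ = Q := by
    rw [Measure.map_map hψ hφ]
    conv_rhs => rw [← Measure.map_id (μ := Q)]
    refine Measure.map_congr ?_
    filter_upwards [hQ] with l hl
    ext i
    simp [φ, ψ, hl i]
  have integral_map {Q : Measure (ι → ℝ)} (hQ : ∀ᵐ l ∂Q, ∀ i, 0 ≤ l i) (n : ι → ℕ) :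
      ∫ l, Real.exp (-∑ i, (n i : ℝ) * (l i : ℝ)) ∂Q.map φ =
        ∫ l, Real.exp (-∑ i, (n i : ℝ) * l i) ∂Q := by
    rw [MeasureTheory.integral_map hφ.aemeasurable
      (Continuous.aestronglyMeasurable (by fun_prop))]
    refine integral_congr_ae ?_
    filter_upwards [hQ] with l hl
    simp [φ, hl]
  have hmap : P.map φ = P'.map φ := ext_of_integral_exp_neg_nnreal fun n => by
    rw [integral_map hP, integral_map hP', h]
  rw [← map_map_self hP, hmap, map_map_self hP']

end LaplaceTransform

section ExponentialMixture

variable {k : ℕ}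

/-- The product of standard exponential profiles `l ↦ ∏ i, l i * exp (-l i)`. -/
def expProfile (l : Fin k → ℝ) : ℝ := ∏ i, l i * Real.exp (-l i)

lemma continuous_expProfile : Continuous (expProfile (k := k)) := by
  unfold expProfile
  fun_prop

lemma expProfile_pos {l : Fin k → ℝ} (hl : ∀ i, 0 < l i) : 0 < expProfile l :=
  Finset.prod_pos fun i _ => mul_pos (hl i) (Real.exp_pos _)

lemma expProfile_le_one {l : Fin k → ℝ} (hl : ∀ i, 0 < l i) : expProfile l ≤ 1 := by
  refine Finset.prod_le_one (fun i _ => (mul_pos (hl i) (Real.exp_pos _)).le) fun i _ => ?_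
  rw [Real.exp_neg, ← div_eq_mul_inv, div_le_one (Real.exp_pos _)]
  linarith [Real.add_one_le_exp (l i)]

variable {ν : Measure (Fin k → ℝ)}

lemma isFiniteMeasure_withDensity_expProfile [IsFiniteMeasure ν]
    (hν : ∀ᵐ l ∂ν, ∀ i, 0 < l i) :
    IsFiniteMeasure (ν.withDensity fun l => ENNReal.ofReal (expProfile l)) := by
  refine isFiniteMeasure_withDensity_ofReal (Integrable.hasFiniteIntegral ?_)
  refine Integrable.of_bound continuous_expProfile.aestronglyMeasurable 1 ?_
  filter_upwards [hν] with l hl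
  rw [Real.norm_of_nonneg (expProfile_pos hl).le]
  exact expProfile_le_one hl

lemma integral_exp_neg_withDensity_expProfile (hν : ∀ᵐ l ∂ν, ∀ i, 0 < l i) (x : Fin k → ℝ) :
    ∫ l, Real.exp (-∑ i, x i * l i) ∂ν.withDensity (fun l => ENNReal.ofReal (expProfile l)) =
      fmix ν fun i => 1 + x i := by
  rw [integral_withDensity_eq_integral_toReal_smul
    continuous_expProfile.measurable.ennreal_ofReal (by simp)]
  refine integral_congr_ae ?_
  filter_upwards [hν] with l hl
  rw [ENNReal.toReal_ofReal (expProfile_pos hl).le, expProfile, ← Finset.sum_neg_distrib,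
    Real.exp_sum, smul_eq_mul, ← Finset.prod_mul_distrib]
  refine Finset.prod_congr rfl fun i _ => ?_
  rw [mul_assoc, ← Real.exp_add]
  ring_nf

lemma withDensity_expProfile_inv (hν : ∀ᵐ l ∂ν, ∀ i, 0 < l i) :
    (ν.withDensity fun l => ENNReal.ofReal (expProfile l)).withDensity
      (fun l => (ENNReal.ofReal (expProfile l))⁻¹) = ν := by
  refine withDensity_inv_same continuous_expProfile.measurable.ennreal_ofReal ?_ (by simp)
  filter_upwards [hν] with l hl
  simpa using expProfile_pos hl

end ExponentialMixture

/-- a mixture of products of exponential densities possesses a unique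
parameter law: if `f_ν = f_{ν'}` on `(0,∞)^k` then `ν = ν'`. -/
theorem stmt11 {k : ℕ} (hk : 1 ≤ k) (ν ν' : Measure (Fin k → ℝ))
    [IsProbabilityMeasure ν] [IsProbabilityMeasure ν']
    (hν : ν {l : Fin k → ℝ | ∀ i, 0 < l i} = 1)
    (hν' : ν' {l : Fin k → ℝ | ∀ i, 0 < l i} = 1)
    (h : ∀ x : Fin k → ℝ, (∀ i, 0 < x i) → fmix ν x = fmix ν' x) :
    ν = ν' := by
  have hmeas : MeasurableSet {l : Fin k → ℝ | ∀ i, 0 < l i} := by measurability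
  have hpos : ∀ᵐ l ∂ν, ∀ i, 0 < l i := (mem_ae_iff_prob_eq_one hmeas).mpr hν
  have hpos' : ∀ᵐ l ∂ν', ∀ i, 0 < l i := (mem_ae_iff_prob_eq_one hmeas).mpr hν'
  have := isFiniteMeasure_withDensity_expProfile hpos
  have := isFiniteMeasure_withDensity_expProfile hpos'
  have key : ν.withDensity (fun l => ENNReal.ofReal (expProfile l)) =
      ν'.withDensity (fun l => ENNReal.ofReal (expProfile l)) := by
    refine ext_of_integral_exp_neg ?_ ?_ fun n => ?_
    · exact (withDensity_absolutelyContinuous _ _).ae_le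
        (hpos.mono fun l hl i => (hl i).le)
    · exact (withDensity_absolutelyContinuous _ _).ae_le
        (hpos'.mono fun l hl i => (hl i).le)
    · rw [integral_exp_neg_withDensity_expProfile hpos (fun i => (n i : ℝ)),
        integral_exp_neg_withDensity_expProfile hpos' (fun i => (n i : ℝ))]
      exact h _ fun i => by positivity
  rw [← withDensity_expProfile_inv hpos, key, withDensity_expProfile_inv hpos']
end
end

section
/- Let k ≥ 1 and let ν be a probability measure on (0,∞)^k with νQ = ν and with support contained in [2,2k²]^k. Then the support of ν is contained in Θ_k. -/
open MeasureTheory ProbabilityTheory Real Finset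

noncomputable section

/-- The Markov kernel `Q(λ, ·) = Σ_{τ ∈ S(0..k)} w_τ(λ) δ_{F_τ(λ)}` at the parameter
level; `ν.bind Qker` is the measure `νQ : A ↦ ∫ Σ_τ w_τ(λ) 1_{F_τ(λ) ∈ A} dν(λ)`. -/
def Qker {k : ℕ} (l : Fin k → ℝ) : Measure (Fin k → ℝ) :=
  ∑ τ : Equiv.Perm (Fin (k + 1)),
    ENNReal.ofReal (w τ l) • Measure.dirac (fun i => F τ i l)

/-- `Θ_k^{(0)} = [2,2k²]^k` and `Θ_k^{(n)} = ⋃_τ F_τ(Θ_k^{(n-1)})`;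
`⋂ n, Theta k n` is the set `Θ_k`. -/
def Theta (k : ℕ) : ℕ → Set (Fin k → ℝ)
  | 0 => {l | ∀ i, l i ∈ Set.Icc (2 : ℝ) (2 * (k : ℝ) ^ 2)}
  | n + 1 => ⋃ τ : Equiv.Perm (Fin (k + 1)), (fun l (i : Fin k) => F τ i l) '' Theta k n

/-- The support of a measure: points all of whose open neighbourhoods have
positive measure. -/
def msupport {k : ℕ} (ν : Measure (Fin k → ℝ)) : Set (Fin k → ℝ) :=
  {x | ∀ U : Set (Fin k → ℝ), IsOpen U → x ∈ U → 0 < ν U}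

theorem continuous_F {k : ℕ} (τ : Equiv.Perm (Fin (k + 1))) (i : Fin k) :
    Continuous (F τ i) := by
  unfold F
  fun_prop

theorem measurable_w {k : ℕ} (τ : Equiv.Perm (Fin (k + 1))) :
    Measurable (w τ : (Fin k → ℝ) → ℝ) := by
  have hF (i : Fin k) : Measurable (F τ i) := (continuous_F τ i).measurable
  unfold w
  fun_prop

theorem Qker_apply {k : ℕ} (l : Fin k → ℝ) (s : Set (Fin k → ℝ)) :
    Qker l s = ∑ τ : Equiv.Perm (Fin (k + 1)),
      ENNReal.ofReal (w τ l) * Measure.dirac (fun i => F τ i l) s := by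
  simp [Qker]

theorem measurable_Qker {k : ℕ} :
    Measurable (Qker : (Fin k → ℝ) → Measure (Fin k → ℝ)) := by
  refine Measure.measurable_of_measurable_coe _ fun s hs => ?_
  simp only [Qker_apply]
  refine Finset.measurable_sum _ fun τ _ => (measurable_w τ).ennreal_ofReal.mul ?_
  have hF : Measurable fun (l : Fin k → ℝ) (i : Fin k) => F τ i l :=
    measurable_pi_lambda _ fun i => (continuous_F τ i).measurable
  exact (Measure.measurable_coe hs).comp (Measure.measurable_dirac.comp hF)

theorem isCompact_Theta (k n : ℕ) : IsCompact (Theta k n) := by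
  induction n with
  | zero =>
    convert isCompact_univ_pi fun _ : Fin k => isCompact_Icc (a := (2 : ℝ)) (b := 2 * (k : ℝ) ^ 2)
    ext l
    simp [Theta, Pi.le_def, forall_and]
  | succ n ih =>
    exact isCompact_iUnion fun τ => ih.image (continuous_pi (continuous_F τ))

theorem measure_compl_eq_zero_of_msupport_subset {k : ℕ} {ν : Measure (Fin k → ℝ)}
    {s : Set (Fin k → ℝ)} (h : msupport ν ⊆ s) : ν sᶜ = 0 := by
  refine measure_null_of_locally_null _ fun x hx => ?_
  have hx' : x ∉ msupport ν := fun hx' => hx (h hx')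
  simp only [msupport, Set.mem_ofPred_eq, not_forall, not_lt, nonpos_iff_eq_zero] at hx'
  obtain ⟨U, hU, hxU, hνU⟩ := hx'
  exact ⟨U, mem_nhdsWithin_of_mem_nhds (hU.mem_nhds hxU), hνU⟩

theorem msupport_subset_of_isClosed {k : ℕ} {ν : Measure (Fin k → ℝ)}
    {s : Set (Fin k → ℝ)} (hs : IsClosed s) (h : ν sᶜ = 0) : msupport ν ⊆ s := by
  intro x hx
  by_contra hxs
  exact (hx sᶜ hs.isOpen_compl hxs).ne' h

theorem Qker_compl_Theta_succ {k n : ℕ} {l : Fin k → ℝ} (hl : l ∈ Theta k n) :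
    Qker l (Theta k (n + 1))ᶜ = 0 := by
  rw [Qker_apply]
  refine Finset.sum_eq_zero fun τ _ => ?_
  have hF : (fun i => F τ i l) ∈ Theta k (n + 1) :=
    Set.mem_iUnion.2 ⟨τ, l, hl, rfl⟩
  rw [Measure.dirac_apply' _ (isCompact_Theta k (n + 1)).measurableSet.compl]
  simp [hF]

theorem measure_compl_Theta_eq_zero {k : ℕ} {ν : Measure (Fin k → ℝ)}
    (hfix : ν.bind Qker = ν) (h : ν (Theta k 0)ᶜ = 0) (n : ℕ) : ν (Theta k n)ᶜ = 0 := by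
  induction n with
  | zero => exact h
  | succ n ih =>
    rw [← hfix, Measure.bind_apply (isCompact_Theta k (n + 1)).measurableSet.compl
      measurable_Qker.aemeasurable]
    refine lintegral_eq_zero_of_ae_eq_zero ?_
    have hn : ∀ᵐ l ∂ν, l ∈ Theta k n := ih
    filter_upwards [hn] with l hl using Qker_compl_Theta_succ hl

/-- if `ν` is a `Q`-invariant probability measure on `(0,∞)^k` whose
support is contained in `[2,2k²]^k`, then its support is contained in `Θ_k`. -/
theorem stmt14 {k : ℕ} (hk : 1 ≤ k) (ν : Measure (Fin k → ℝ)) [IsProbabilityMeasure ν]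
    (hν : ν {l : Fin k → ℝ | ∀ i, 0 < l i} = 1)
    (hfix : ν.bind Qker = ν)
    (hsupp : msupport ν ⊆ Theta k 0) :
    msupport ν ⊆ ⋂ n, Theta k n := by
  exact Set.subset_iInter fun n =>
    msupport_subset_of_isClosed (isCompact_Theta k n).isClosed
      (measure_compl_Theta_eq_zero hfix (measure_compl_eq_zero_of_msupport_subset hsupp) n)
end
end

section
/- For k = 2, each of the six maps F_τ, τ a permutation of {0,1,2}, maps the square [2,8]² into itself and is a contraction on [2,8]² for the Euclidean distance: there exists L < 1 such that ‖F_τ(λ) − F_τ(λ′)‖₂ ≤ L‖λ − λ′‖₂ for all λ, λ′ ∈ [2,8]² and all six permutations τ. -/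
open MeasureTheory Real Finset

noncomputable section

theorem Eset_fin_three_cases (τ : Equiv.Perm (Fin 3)) :
    (Eset τ 0 = {0} ∧ Eset τ 1 = {1}) ∨ (Eset τ 0 = {1} ∧ Eset τ 1 = {0}) ∨
    (Eset τ 0 = {0} ∧ Eset τ 1 = {0, 1}) ∨ (Eset τ 0 = {1} ∧ Eset τ 1 = {0, 1}) ∨
    (Eset τ 0 = {0, 1} ∧ Eset τ 1 = {0}) ∨ (Eset τ 0 = {0, 1} ∧ Eset τ 1 = {1}) := by
  revert τ
  decide

theorem sqrt_two_mul_mem_Icc {x : ℝ} (hx : x ∈ Set.Icc (2 : ℝ) 8) :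
    √(2 * x) ∈ Set.Icc (2 : ℝ) 4 := by
  obtain ⟨h₁, h₂⟩ := hx
  exact ⟨Real.le_sqrt_of_sq_le (by linarith), Real.sqrt_le_iff.2 ⟨by norm_num, by linarith⟩⟩

theorem sq_sqrt_two_mul_sub_le {x y : ℝ} (hx : x ∈ Set.Icc (2 : ℝ) 8)
    (hy : y ∈ Set.Icc (2 : ℝ) 8) :
    4 * (√(2 * x) - √(2 * y)) ^ 2 ≤ (x - y) ^ 2 := by
  have hx' := (sqrt_two_mul_mem_Icc hx).1
  have hy' := (sqrt_two_mul_mem_Icc hy).1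
  have ex : √(2 * x) ^ 2 = 2 * x := Real.sq_sqrt (by linarith [hx.1])
  have ey : √(2 * y) ^ 2 = 2 * y := Real.sq_sqrt (by linarith [hy.1])
  have e : 2 * (x - y) = (√(2 * x) - √(2 * y)) * (√(2 * x) + √(2 * y)) := by
    linear_combination ey - ex
  have h : (4 : ℝ) ^ 2 ≤ (√(2 * x) + √(2 * y)) ^ 2 := by gcongr; linarith
  have := mul_le_mul_of_nonneg_left h (sq_nonneg (√(2 * x) - √(2 * y)))
  rw [← mul_pow, ← mul_pow, ← e] at this
  linarith

/-- for `k = 2`, each of the six maps `F_τ` maps `[2,8]²` into itself and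
there is a common contraction constant `L < 1` for the Euclidean distance on `[2,8]²`. -/
theorem stmt15 :
    ∃ L : ℝ, L < 1 ∧
      ∀ τ : Equiv.Perm (Fin 3),
        (∀ l : Fin 2 → ℝ, (∀ i, l i ∈ Set.Icc (2 : ℝ) 8) →
          ∀ i, F τ i l ∈ Set.Icc (2 : ℝ) 8) ∧
        (∀ l l' : Fin 2 → ℝ, (∀ i, l i ∈ Set.Icc (2 : ℝ) 8) →
          (∀ i, l' i ∈ Set.Icc (2 : ℝ) 8) →
          Real.sqrt ((F τ 0 l - F τ 0 l') ^ 2 + (F τ 1 l - F τ 1 l') ^ 2) ≤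
            L * Real.sqrt ((l 0 - l' 0) ^ 2 + (l 1 - l' 1) ^ 2)) := by
  refine ⟨9 / 10, by norm_num, fun τ => ⟨fun l hl i => ?_, fun l l' hl hl' => ?_⟩⟩
  · obtain ⟨a₁, a₂⟩ := sqrt_two_mul_mem_Icc (hl 0)
    obtain ⟨b₁, b₂⟩ := sqrt_two_mul_mem_Icc (hl 1)
    rcases Eset_fin_three_cases τ with h | h | h | h | h | h <;>
      revert i <;> rw [Fin.forall_fin_two] <;>
      simp only [F, h.1, h.2, Finset.sum_singleton, Set.mem_Icc,
        Finset.sum_pair (zero_ne_one : (0 : Fin 2) ≠ 1)] <;>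
      refine ⟨⟨?_, ?_⟩, ?_, ?_⟩ <;> linarith
  · have ha := sq_sqrt_two_mul_sub_le (hl 0) (hl' 0)
    have hb := sq_sqrt_two_mul_sub_le (hl 1) (hl' 1)
    have key : (F τ 0 l - F τ 0 l') ^ 2 + (F τ 1 l - F τ 1 l') ^ 2 ≤
        (9 / 10) ^ 2 * ((l 0 - l' 0) ^ 2 + (l 1 - l' 1) ^ 2) := by
      rcases Eset_fin_three_cases τ with h | h | h | h | h | h <;>
        simp only [F, h.1, h.2, Finset.sum_singleton,
          Finset.sum_pair (zero_ne_one : (0 : Fin 2) ≠ 1)] <;>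
        nlinarith [sq_nonneg (l 0 - l' 0), sq_nonneg (l 1 - l' 1),
          sq_nonneg ((√(2 * l 0) - √(2 * l' 0)) - (√(2 * l 1) - √(2 * l' 1)))]
    calc _ ≤ √((9 / 10) ^ 2 * ((l 0 - l' 0) ^ 2 + (l 1 - l' 1) ^ 2)) := Real.sqrt_le_sqrt key
      _ = _ := by rw [Real.sqrt_mul (by positivity), Real.sqrt_sq (by norm_num)]
end
end
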